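/- For every x ∈ ℝ: each function t ↦ log H_i(t) is twice differentiable at x, Σ_{i=1}^{m+1} h_i′(x) = 0 where h_i′ denotes the derivative of h_i (with the conventions making h₁ and h_{m+1} use f(±∞ − x) = 0), and consequently −Σ_{i=1}^{m+1} H_i(x) · (log H_i)″(x) = Σ_{i=1}^{m+1} h_i(x)² / H_i(x). -/

import Mathlib

set_option autoImplicit false

open MeasureTheory ProbabilityTheory Filter Finset Matrix

/-- The density of the Gaussian distribution `N(0, σ²)`. -/
noncomputable def gaussPdf (σ x : ℝ) : ℝ :=
  (σ * Real.sqrt (2 * Real.pi))⁻¹ * Real.exp (-(x ^ 2) / (2 * σ ^ 2))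

/-- The cumulative distribution function of the Gaussian distribution `N(0, σ²)`. -/
noncomputable def gaussCdf (σ x : ℝ) : ℝ := ∫ t in Set.Iic x, gaussPdf σ t

/-- `H i x = F(Cᵢ - x) - F(Cᵢ₋₁ - x)` for `i = 1, …, m+1`, with the conventions
`C₀ = -∞`, `C_{m+1} = +∞` (so `F(C₀ - x) = 0` and `F(C_{m+1} - x) = 1`). -/
noncomputable def Hfun (σ : ℝ) (m : ℕ) (C : ℕ → ℝ) (i : ℕ) (x : ℝ) : ℝ :=
  if i = 1 then gaussCdf σ (C 1 - x)
  else if i = m + 1 then 1 - gaussCdf σ (C m - x)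
  else gaussCdf σ (C i - x) - gaussCdf σ (C (i - 1) - x)

/-- `h i x = f(Cᵢ - x) - f(Cᵢ₋₁ - x)` for `i = 1, …, m+1`, with the conventions
`C₀ = -∞`, `C_{m+1} = +∞` (so `f(C₀ - x) = f(C_{m+1} - x) = 0`). -/
noncomputable def hfun (σ : ℝ) (m : ℕ) (C : ℕ → ℝ) (i : ℕ) (x : ℝ) : ℝ :=
  if i = 1 then gaussPdf σ (C 1 - x)
  else if i = m + 1 then -gaussPdf σ (C m - x)
  else gaussPdf σ (C i - x) - gaussPdf σ (C (i - 1) - x)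

lemma gaussPdf_pos {σ : ℝ} (hσ : 0 < σ) (x : ℝ) : 0 < gaussPdf σ x := by
  unfold gaussPdf
  have := Real.pi_pos
  positivity

lemma gaussPdf_eq {σ : ℝ} (hσ : 0 < σ) :
    gaussPdf σ = gaussianPDFReal 0 (⟨σ ^ 2, sq_nonneg σ⟩ : NNReal) := by
  funext x
  have h : Real.sqrt (2 * Real.pi * σ ^ 2) = σ * Real.sqrt (2 * Real.pi) := by
    rw [Real.sqrt_mul (by positivity), Real.sqrt_sq hσ.le, mul_comm]
  simp only [gaussPdf, gaussianPDFReal, sub_zero]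
  rw [← h]
  rfl

lemma gaussPdf_integrable {σ : ℝ} (hσ : 0 < σ) : Integrable (gaussPdf σ) := by
  rw [gaussPdf_eq hσ]
  exact integrable_gaussianPDFReal _ _

lemma gaussPdf_integral {σ : ℝ} (hσ : 0 < σ) : ∫ x, gaussPdf σ x = 1 := by
  rw [gaussPdf_eq hσ]
  apply integral_gaussianPDFReal_eq_one
  intro h
  have h2 := congrArg NNReal.toReal h
  have h3 : σ ^ 2 = 0 := h2
  exact hσ.ne' (by simpa using h3)

lemma gaussPdf_differentiable (σ : ℝ) : Differentiable ℝ (gaussPdf σ) := by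
  unfold gaussPdf
  fun_prop

lemma gaussCdf_hasDerivAt {σ : ℝ} (hσ : 0 < σ) (x : ℝ) :
    HasDerivAt (gaussCdf σ) (gaussPdf σ x) x := by
  have hi := gaussPdf_integrable hσ
  have e : gaussCdf σ = fun y => gaussCdf σ 0 + ∫ t in (0 : ℝ)..y, gaussPdf σ t := by
    funext y
    have := intervalIntegral.integral_Iic_sub_Iic (μ := volume) (f := gaussPdf σ) (a := 0) (b := y)
      hi.integrableOn hi.integrableOn
    simp only [gaussCdf]
    linarith
  rw [e]
  exact ((gaussPdf_differentiable σ).continuous.integral_hasStrictDerivAt 0 x).hasDerivAt.const_add _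

lemma gaussCdf_strictMono {σ : ℝ} (hσ : 0 < σ) : StrictMono (gaussCdf σ) := by
  apply strictMono_of_deriv_pos
  intro x
  rw [(gaussCdf_hasDerivAt hσ x).deriv]
  exact gaussPdf_pos hσ x

lemma gaussCdf_pos {σ : ℝ} (hσ : 0 < σ) (x : ℝ) : 0 < gaussCdf σ x := by
  have h1 : 0 ≤ gaussCdf σ (x - 1) := integral_nonneg fun t => (gaussPdf_pos hσ t).le
  exact h1.trans_lt (gaussCdf_strictMono hσ (by linarith))

lemma gaussCdf_lt_one {σ : ℝ} (hσ : 0 < σ) (x : ℝ) : gaussCdf σ x < 1 := by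
  have h1 : gaussCdf σ (x + 1) ≤ 1 := by
    rw [← gaussPdf_integral hσ]
    exact setIntegral_le_integral (gaussPdf_integrable hσ)
      (Eventually.of_forall fun t => (gaussPdf_pos hσ t).le)
  exact (gaussCdf_strictMono hσ (by linarith : x < x + 1)).trans_le h1

lemma Hfun_pos {σ : ℝ} (hσ : 0 < σ) {m : ℕ}
    (C : ℕ → ℝ) (hC : ∀ i j, 1 ≤ i → i < j → j ≤ m → C i < C j) (i : ℕ)
    (hi : i ∈ Icc 1 (m + 1)) (x : ℝ) : 0 < Hfun σ m C i x := by
  rw [Finset.mem_Icc] at hi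
  unfold Hfun
  split_ifs with h1 h2
  · exact gaussCdf_pos hσ _
  · exact sub_pos.2 (gaussCdf_lt_one hσ _)
  · have := hC (i - 1) i (by omega) (by omega) (by omega)
    exact sub_pos.2 (gaussCdf_strictMono hσ (by linarith))

lemma Hfun_hasDerivAt {σ : ℝ} (hσ : 0 < σ) (m : ℕ) (C : ℕ → ℝ) (i : ℕ) (x : ℝ) :
    HasDerivAt (Hfun σ m C i) (-hfun σ m C i x) x := by
  have key : ∀ c : ℝ, HasDerivAt (fun t => gaussCdf σ (c - t)) (-gaussPdf σ (c - x)) x := by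
    intro c
    exact (gaussCdf_hasDerivAt hσ (c - x)).comp_const_sub c x
  unfold Hfun hfun
  split_ifs with h1 h2
  · exact key _
  · exact (key (C m)).const_sub 1
  · exact ((key (C i)).sub (key (C (i - 1)))).congr_deriv (by ring)

lemma hfun_differentiable (σ : ℝ) (m : ℕ) (C : ℕ → ℝ) (i : ℕ) :
    Differentiable ℝ (hfun σ m C i) := by
  have key : ∀ c : ℝ, Differentiable ℝ (fun t => gaussPdf σ (c - t)) := fun c =>
    (gaussPdf_differentiable σ).comp (differentiable_id.const_sub c)
  unfold hfun
  split_ifs with h1 h2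
  · exact key _
  · exact (key (C m)).neg
  · exact (key (C i)).sub (key (C (i - 1)))

lemma hfun_partial_sum (σ : ℝ) (m : ℕ) (C : ℕ → ℝ) (x : ℝ) (k : ℕ) (hk : 1 ≤ k) (hkm : k ≤ m) :
    ∑ i ∈ Icc 1 k, hfun σ m C i x = gaussPdf σ (C k - x) := by
  induction k, hk using Nat.le_induction with
  | base => simp [hfun]
  | succ k hk ih =>
    rw [Finset.sum_Icc_succ_top (by omega), ih (by omega), hfun, if_neg (by omega),
      if_neg (by omega)]
    simp

lemma hfun_sum (σ : ℝ) {m : ℕ} (hm : 1 ≤ m) (C : ℕ → ℝ) (x : ℝ) :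
    ∑ i ∈ Icc 1 (m + 1), hfun σ m C i x = 0 := by
  rw [Finset.sum_Icc_succ_top (by omega), hfun_partial_sum σ m C x m hm le_rfl, hfun,
    if_neg (by omega), if_pos rfl]
  ring

/-- each `log Hᵢ` is twice differentiable, `Σᵢ hᵢ′(x) = 0`, and
`-Σᵢ Hᵢ(x)·(log Hᵢ)″(x) = Σᵢ hᵢ(x)²/Hᵢ(x)`. -/
theorem stmt_17 {σ : ℝ} (hσ : 0 < σ) {m : ℕ} (hm : 1 ≤ m)
    (C : ℕ → ℝ) (hC : ∀ i j, 1 ≤ i → i < j → j ≤ m → C i < C j) :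
    ∀ x : ℝ,
      (∀ i ∈ Icc 1 (m + 1),
        DifferentiableAt ℝ (fun t => Real.log (Hfun σ m C i t)) x ∧
        DifferentiableAt ℝ (deriv (fun t => Real.log (Hfun σ m C i t))) x) ∧
      (∑ i ∈ Icc 1 (m + 1), deriv (fun t => hfun σ m C i t) x = 0) ∧
      (-∑ i ∈ Icc 1 (m + 1),
          Hfun σ m C i x * deriv (deriv (fun t => Real.log (Hfun σ m C i t))) x
        = ∑ i ∈ Icc 1 (m + 1), (hfun σ m C i x) ^ 2 / Hfun σ m C i x) := by
  intro x
  have hlog : ∀ i ∈ Icc 1 (m + 1), ∀ t, HasDerivAt (fun t => Real.log (Hfun σ m C i t))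
      (-hfun σ m C i t / Hfun σ m C i t) t := fun i hi t =>
    (Hfun_hasDerivAt hσ m C i t).log (Hfun_pos hσ C hC i hi t).ne'
  have hlog2 : ∀ i ∈ Icc 1 (m + 1), HasDerivAt (deriv (fun t => Real.log (Hfun σ m C i t)))
      ((-deriv (hfun σ m C i) x * Hfun σ m C i x - -hfun σ m C i x * -hfun σ m C i x)
        / Hfun σ m C i x ^ 2) x := by
    intro i hi
    rw [show deriv (fun t => Real.log (Hfun σ m C i t))
      = fun t => -hfun σ m C i t / Hfun σ m C i t from funext fun t => (hlog i hi t).deriv]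
    exact ((hfun_differentiable σ m C i x).hasDerivAt.neg).fun_div (Hfun_hasDerivAt hσ m C i x)
      (Hfun_pos hσ C hC i hi x).ne'
  have hsum : ∑ i ∈ Icc 1 (m + 1), deriv (fun t => hfun σ m C i t) x = 0 := by
    rw [← deriv_fun_sum fun i _ => hfun_differentiable σ m C i x]
    simp [hfun_sum σ hm C]
  refine ⟨fun i hi => ⟨(hlog i hi x).differentiableAt, (hlog2 i hi).differentiableAt⟩, hsum, ?_⟩
  have : ∀ i ∈ Icc 1 (m + 1),
      Hfun σ m C i x * deriv (deriv (fun t => Real.log (Hfun σ m C i t))) x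
        = -deriv (fun t => hfun σ m C i t) x - (hfun σ m C i x) ^ 2 / Hfun σ m C i x := by
    intro i hi
    rw [(hlog2 i hi).deriv]
    have := (Hfun_pos hσ C hC i hi x).ne'
    field_simp
  rw [Finset.sum_congr rfl this, Finset.sum_sub_distrib, Finset.sum_neg_distrib, hsum]
  ring
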